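/- Let A and B be nonempty finite types and let P be a projection on ℂ^(A×B) that supports a quantum channel. Then the one-shot simulation cost dominates the revised semidefinite packing number: Σ(P) ≥ Ã(P). -/

import Mathlib

open Matrix Kronecker BigOperators
open scoped ComplexOrder

noncomputable section

/-- Loewner order: `M ≤ N` iff `N - M` is positive semidefinite. -/
def loe {n : Type*} [Fintype n] (M N : Matrix n n ℂ) : Prop := (N - M).PosSemidef

/-- A projection: Hermitian and idempotent. -/
def IsProj {n : Type*} [Fintype n] (M : Matrix n n ℂ) : Prop := M.IsHermitian ∧ M * M = M

variable {A B : Type*} [Fintype A] [Fintype B] [DecidableEq A] [DecidableEq B]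

/-- Partial trace over `A`. -/
def trA (M : Matrix (A × B) (A × B) ℂ) : Matrix B B ℂ :=
  Matrix.of fun b b' => ∑ a, M (a, b) (a, b')

/-- Partial trace over `B`. -/
def trB (M : Matrix (A × B) (A × B) ℂ) : Matrix A A ℂ :=
  Matrix.of fun a a' => ∑ b, M (a, b) (a', b)

/-- `P` supports a quantum channel: there is a PSD `J` supported on `P` with `Tr_B J = 1`. -/
def SupportsChannel (P : Matrix (A × B) (A × B) ℂ) : Prop :=
  ∃ J : Matrix (A × B) (A × B) ℂ, J.PosSemidef ∧ P * J = J ∧ trB J = 1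

/-- One-shot no-signalling assisted simulation cost (primal SDP). -/
def SigmaNS (P : Matrix (A × B) (A × B) ℂ) : ℝ :=
  sInf { x : ℝ | ∃ T : Matrix B B ℂ, T.IsHermitian ∧ x = T.trace.re ∧
    ∃ F : Matrix (A × B) (A × B) ℂ,
      loe 0 F ∧ loe F ((1 : Matrix A A ℂ) ⊗ₖ T) ∧ trB F = 1 ∧
      ((1 - P) * F).trace = 0 }

/-- Revised semidefinite packing number (primal SDP). -/
def AramTilde (P : Matrix (A × B) (A × B) ℂ) : ℝ :=
  sSup { x : ℝ | ∃ S : Matrix A A ℂ, S.PosSemidef ∧ x = S.trace.re ∧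
    loe (trA (P * (S ⊗ₖ (1 : Matrix B B ℂ)) * P)) 1 }

theorem psd_factor_aux {n : Type*} [Fintype n] [DecidableEq n] {X : Matrix n n ℂ}
    (hX : X.PosSemidef) : ∃ C : Matrix n n ℂ, X = Cᴴ * C := by
  open scoped MatrixOrder Matrix.Norms.L2Operator in
  exact CStarAlgebra.nonneg_iff_eq_star_mul_self.mp hX.nonneg

theorem trace_mul_re_nonneg_aux {n : Type*} [Fintype n] [DecidableEq n] {X Y : Matrix n n ℂ}
    (hX : X.PosSemidef) (hY : Y.PosSemidef) : 0 ≤ ((X * Y).trace).re := by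
  obtain ⟨C, rfl⟩ := psd_factor_aux hX
  rw [Matrix.mul_assoc, Matrix.trace_mul_comm]
  have := (hY.mul_mul_conjTranspose_same C).trace_nonneg
  exact (Complex.le_def.mp this).1

theorem le_smul_one_aux {n : Type*} [Fintype n] [DecidableEq n] {X : Matrix n n ℂ}
    (hX : X.PosSemidef) : ∃ c : ℝ, ((c : ℂ) • (1 : Matrix n n ℂ) - X).PosSemidef := by
  open scoped MatrixOrder Matrix.Norms.L2Operator in
  have h := IsSelfAdjoint.le_algebraMap_norm_self (a := X) hX.1
  refine ⟨‖X‖, ?_⟩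
  have h2 := Matrix.le_iff.mp h
  have h3 : ((‖X‖ : ℝ) : ℂ) • (1 : Matrix n n ℂ) = algebraMap ℝ (Matrix n n ℂ) ‖X‖ := by
    rw [Algebra.algebraMap_eq_smul_one]
    ext i j
    simp
  rw [h3]
  exact h2

theorem supp_aux {n : Type*} [Fintype n] [DecidableEq n] {P F : Matrix n n ℂ}
    (hP : IsProj P) (hF : F.PosSemidef) (h : ((1 - P) * F).trace = 0) :
    F = P * F * P := by
  obtain ⟨C, rfl⟩ := psd_factor_aux hF
  obtain ⟨hH, hPP⟩ := hP
  have hQ : (1 - P) * (1 - P) = 1 - P := by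
    simp [sub_mul, mul_sub, hPP]
  have hQH : (1 - P)ᴴ = 1 - P := by
    rw [conjTranspose_sub, hH.eq]; simp
  have h0 : C * (1 - P) = 0 := by
    rw [← Matrix.trace_conjTranspose_mul_self_eq_zero_iff]
    rw [conjTranspose_mul, hQH, ← h]
    rw [← Matrix.mul_assoc, Matrix.trace_mul_comm, ← Matrix.mul_assoc, ← Matrix.mul_assoc, hQ,
      Matrix.mul_assoc]
  have h1 : C * P = C := by
    rw [mul_sub, mul_one, sub_eq_zero] at h0; exact h0.symm
  have h2 : P * Cᴴ = Cᴴ := by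
    have := congrArg conjTranspose h1
    rwa [conjTranspose_mul, hH.eq] at this
  rw [← Matrix.mul_assoc, h2, Matrix.mul_assoc, h1]

theorem trace_kron_one_aux (F : Matrix (A × B) (A × B) ℂ) (S : Matrix A A ℂ) :
    (F * (S ⊗ₖ (1 : Matrix B B ℂ))).trace = (trB F * S).trace := by
  simp only [Matrix.trace, Matrix.diag, Matrix.mul_apply, trB, Matrix.of_apply,
    Fintype.sum_prod_type, Matrix.kroneckerMap_apply, Matrix.one_apply, mul_ite, mul_one, mul_zero,
    Finset.sum_ite_eq', Finset.mem_univ, if_true, Finset.sum_mul]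
  refine Finset.sum_congr rfl fun a _ => ?_
  rw [Finset.sum_comm]

theorem trace_one_kron_aux (M : Matrix (A × B) (A × B) ℂ) (T : Matrix B B ℂ) :
    (((1 : Matrix A A ℂ) ⊗ₖ T) * M).trace = (T * trA M).trace := by
  simp only [Matrix.trace, Matrix.diag, Matrix.mul_apply, trA, Matrix.of_apply,
    Fintype.sum_prod_type, Matrix.kroneckerMap_apply, Matrix.one_apply, ite_mul, one_mul, zero_mul,
    Finset.sum_ite_irrel, Finset.sum_const_zero,
    Finset.sum_ite_eq, Finset.mem_univ, if_true, Finset.mul_sum]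
  rw [Finset.sum_comm]
  refine Finset.sum_congr rfl fun a _ => ?_
  rw [Finset.sum_comm]

/-- The one-shot simulation cost dominates the revised semidefinite packing number. -/
theorem sigma_ge_aramTilde [Nonempty A] [Nonempty B]
    (P : Matrix (A × B) (A × B) ℂ) (hP : IsProj P) (hch : SupportsChannel P) :
    SigmaNS P ≥ AramTilde P := by
  unfold SigmaNS AramTilde
  apply le_csInf
  · obtain ⟨J, hJ, hPJ, hJ1⟩ := hch
    obtain ⟨c, hc⟩ := le_smul_one_aux hJ
    refine ⟨_, (c : ℂ) • (1 : Matrix B B ℂ), ?_, rfl, J, ?_, ?_, hJ1, ?_⟩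
    · ext i j
      by_cases h : i = j
      · subst h; simp
      · simp [Matrix.one_apply, h, Ne.symm h]
    · simpa [loe] using hJ
    · rw [loe, Matrix.kronecker_smul, Matrix.one_kronecker_one]
      exact hc
    · rw [sub_mul, hPJ]; simp
  · rintro x ⟨T, hT, rfl, F, hF0, hFT, hF1, hFP⟩
    apply csSup_le
    · refine ⟨_, 0, Matrix.PosSemidef.zero, rfl, ?_⟩
      have : trA (P * ((0 : Matrix A A ℂ) ⊗ₖ (1 : Matrix B B ℂ)) * P) = 0 := by
        rw [Matrix.zero_kronecker]; ext i j; simp [trA]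
      rw [loe, this, sub_zero]
      exact Matrix.PosSemidef.one
    · rintro y ⟨S, hS, rfl, hS1⟩
      have hF : F.PosSemidef := by simpa [loe] using hF0
      have hFs := supp_aux hP hF hFP
      have hT0 : T.PosSemidef := by
        have h1 : ((1 : Matrix A A ℂ) ⊗ₖ T).PosSemidef := by
          have := hFT.add hF
          simpa using this
        obtain ⟨a⟩ := ‹Nonempty A›
        have h2 := h1.submatrix (fun b : B => (a, b))
        convert h2 using 1
        ext i j
        simp
      have hSk : (P * (S ⊗ₖ (1 : Matrix B B ℂ)) * P).PosSemidef := by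
        have := (hS.kronecker (Matrix.PosSemidef.one (n := B) (R := ℂ))).mul_mul_conjTranspose_same P
        rwa [hP.1.eq] at this
      have e1 : S.trace = (F * (P * (S ⊗ₖ (1 : Matrix B B ℂ)) * P)).trace := by
        have h := trace_kron_one_aux F S
        rw [hF1, one_mul] at h
        rw [← h, hFs]
        have hPP := hP.2
        rw [Matrix.mul_assoc (P * F) P, Matrix.mul_assoc P F, Matrix.trace_mul_comm P]
        rw [← hFs]
        simp only [Matrix.mul_assoc]
      have i1 := trace_mul_re_nonneg_aux hFT hSk
      have i2 := trace_mul_re_nonneg_aux hT0 hS1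
      rw [sub_mul, Matrix.trace_sub, trace_one_kron_aux, ← e1, Complex.sub_re] at i1
      rw [mul_sub, mul_one, Matrix.trace_sub, Complex.sub_re] at i2
      linarith
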